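/- arXiv:2602.09123 — 2 statements merged into one kernel-verified Lean document; each statement's English description precedes it below -/
import Mathlib

section
/- Let M ≥ 1, N ≥ 1, λ ≥ 0, and let d : Fin N → ZMod M → ZMod M → ℝ be additive. Then for every configuration σ : ZMod M → Fin N, the Potts energy is bounded below by the domain-wall (Ising) energy of its wall set: H(σ) ≥ E(W(σ)), where W(σ) = {j ∈ ZMod M : σ (j−1) ≠ σ j}. -/
/-- The wall set of a spin configuration `σ` on the cycle `ZMod M`:
the set of sites `j` where the spin changes between `j - 1` and `j`. -/
def wallSet {M N : ℕ} [NeZero M] (σ : ZMod M → Fin N) : Finset (ZMod M) :=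
  Finset.univ.filter fun j => σ (j - 1) ≠ σ j

/-- The cyclic successor of `p` within a finset `W ⊆ ZMod M`: `p + k` where
`k` is the least positive natural number with `p + k ∈ W` (such a `k ≤ M`
exists whenever `W` is nonempty; otherwise we return `p` itself). -/
noncomputable def nextWall {M : ℕ} (W : Finset (ZMod M)) (p : ZMod M) : ZMod M :=
  open Classical in
  if h : ∃ k : ℕ, 0 < k ∧ p + (k : ZMod M) ∈ W then p + ((Nat.find h : ℕ) : ZMod M)
  else p

/-- The Potts energy of a configuration `σ : ZMod M → Fin N` with onsite
field `d` and nearest-neighbor coupling `lam`: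
`H(σ) = -(∑ j, d (σ j) j (j+1)) - lam * #{j : σ j = σ (j+1)}`. -/
def pottsEnergy {M N : ℕ} [NeZero M] (lam : ℝ)
    (d : Fin N → ZMod M → ZMod M → ℝ) (σ : ZMod M → Fin N) : ℝ :=
  -(∑ j : ZMod M, d (σ j) j (j + 1))
    - lam * ((Finset.univ.filter fun j : ZMod M => σ j = σ (j + 1)).card : ℝ)

/-- The domain-wall (Ising) energy of a finset `W ⊆ ZMod M` of wall
positions, with couplings `J p q = max_i d i p q`:
`E(W) = -(∑ p ∈ W, max_i d i p (next_W p)) - lam * (M - #W)` for nonempty `W`,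
and `E(∅) = -lam * M`. -/
noncomputable def isingEnergy {M N : ℕ} [NeZero M] [NeZero N] (lam : ℝ)
    (d : Fin N → ZMod M → ZMod M → ℝ) (W : Finset (ZMod M)) : ℝ :=
  if W.Nonempty then
    -(∑ p ∈ W, Finset.univ.sup' Finset.univ_nonempty
        fun i : Fin N => d i p (nextWall W p))
      - lam * ((M - W.card : ℕ) : ℝ)
  else -lam * (M : ℝ)

lemma nextWall_spec {M : ℕ} [NeZero M] {W : Finset (ZMod M)} {p : ZMod M} (hp : p ∈ W) :
    ∃ k : ℕ, 0 < k ∧ nextWall W p = p + (k : ZMod M) ∧ p + (k : ZMod M) ∈ W ∧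
      ∀ m : ℕ, 0 < m → m < k → p + (m : ZMod M) ∉ W := by
  classical
  have h : ∃ k : ℕ, 0 < k ∧ p + (k : ZMod M) ∈ W :=
    ⟨M, Nat.pos_of_ne_zero (NeZero.ne M), by simpa using hp⟩
  refine ⟨Nat.find h, (Nat.find_spec h).1, ?_, (Nat.find_spec h).2,
    fun m hm hlt hmem => Nat.find_min h hlt ⟨hm, hmem⟩⟩
  rw [nextWall, dif_pos h]

lemma nextWall_mem {M : ℕ} [NeZero M] {W : Finset (ZMod M)} {p : ZMod M} (hp : p ∈ W) :
    nextWall W p ∈ W := by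
  obtain ⟨k, -, hk, hmem, -⟩ := nextWall_spec hp
  rwa [hk]

lemma nextWall_injOn {M : ℕ} [NeZero M] (W : Finset (ZMod M)) :
    Set.InjOn (nextWall W) W := by
  have not_lt : ∀ {p q : ZMod M} {k l : ℕ}, p ∈ W → 0 < k →
      (∀ m : ℕ, 0 < m → m < l → q + (m : ZMod M) ∉ W) →
      p + (k : ZMod M) = q + (l : ZMod M) → ¬ k < l := by
    intro p q k l hp hk hl h hlt
    refine hl (l - k) (by omega) (by omega) ?_
    have hpq : q + ((l - k : ℕ) : ZMod M) = p := by
      rw [Nat.cast_sub hlt.le]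
      linear_combination -h
    rwa [hpq]
  intro p hp q hq h
  obtain ⟨k, hk, hpk, -, hkmin⟩ := nextWall_spec (Finset.mem_coe.mp hp)
  obtain ⟨l, hl, hql, -, hlmin⟩ := nextWall_spec (Finset.mem_coe.mp hq)
  rw [hpk, hql] at h
  have hkl : k = l :=
    le_antisymm (Nat.le_of_not_lt (not_lt hq hl hkmin h.symm))
      (Nat.le_of_not_lt (not_lt hp hk hlmin h))
  subst hkl
  exact add_right_cancel h

lemma sum_nextWall {M : ℕ} [NeZero M] (W : Finset (ZMod M)) (g : ZMod M → ℝ) :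
    ∑ p ∈ W, g (nextWall W p) = ∑ p ∈ W, g p := by
  classical
  have himage : W.image (nextWall W) = W :=
    Finset.eq_of_subset_of_card_le (Finset.image_subset_iff.mpr fun _ hp => nextWall_mem hp)
      (Finset.card_image_of_injOn (nextWall_injOn W)).ge
  conv_rhs => rw [← himage, Finset.sum_image (nextWall_injOn W)]

/-- The spin is constant on each domain, so it can be read off at its last site. -/
lemma spin_nextWall_sub_one {M N : ℕ} [NeZero M] (σ : ZMod M → Fin N) {p : ZMod M}
    (hp : p ∈ wallSet σ) : σ (nextWall (wallSet σ) p - 1) = σ p := by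
  obtain ⟨k, hk, hpk, -, hmin⟩ := nextWall_spec hp
  have hconst : ∀ m : ℕ, m < k → σ (p + (m : ZMod M)) = σ p := by
    intro m
    induction m with
    | zero => simp
    | succ m ih =>
      intro hm
      have hnot := hmin (m + 1) m.succ_pos hm
      have hstep : p + ((m + 1 : ℕ) : ZMod M) - 1 = p + (m : ZMod M) := by
        push_cast
        ring
      simp only [wallSet, Finset.mem_filter, Finset.mem_univ, true_and, not_not, hstep] at hnot
      rw [← hnot, ih (by omega)]
  have hlast : p + (k : ZMod M) - 1 = p + ((k - 1 : ℕ) : ZMod M) := by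
    rw [Nat.cast_sub hk]
    push_cast
    ring
  rw [hpk, hlast, hconst (k - 1) (by omega)]

lemma card_filter_spin_eq {M N : ℕ} [NeZero M] (σ : ZMod M → Fin N) :
    (Finset.univ.filter fun j : ZMod M => σ j = σ (j + 1)).card = M - (wallSet σ).card := by
  have hcompl : (Finset.univ.filter fun j : ZMod M => σ j = σ (j + 1)).card
      = (wallSet σ)ᶜ.card := by
    refine Finset.card_equiv (Equiv.addRight 1) fun j => ?_
    simp [wallSet]
  rw [hcompl, Finset.card_compl, ZMod.card]

/-- The onsite energy of a configuration, summed site by site, equals its sum over domains. -/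
lemma sum_field_eq_sum_domains {M N : ℕ} [NeZero M] {d : Fin N → ZMod M → ZMod M → ℝ}
    (hadd : ∀ (i : Fin N) (j l k : ZMod M), d i j l + d i l k = d i j k)
    (σ : ZMod M → Fin N) :
    ∑ j, d (σ j) j (j + 1)
      = ∑ p ∈ wallSet σ, d (σ p) p (nextWall (wallSet σ) p) := by
  have hdiff : ∀ i j k, d i j k = d i 0 k - d i 0 j := fun i j k => by
    linarith [hadd i 0 j k]
  have hshift : ∑ j, d (σ j) 0 (j + 1) = ∑ j, d (σ (j - 1)) 0 j :=
    Fintype.sum_equiv (Equiv.addRight 1) _ _ fun j => by simp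
  have hdomain : ∑ p ∈ wallSet σ, d (σ p) 0 (nextWall (wallSet σ) p)
      = ∑ p ∈ wallSet σ, d (σ (p - 1)) 0 p := by
    rw [← sum_nextWall (wallSet σ) fun p => d (σ (p - 1)) 0 p]
    exact Finset.sum_congr rfl fun p hp => by rw [spin_nextWall_sub_one σ hp]
  calc ∑ j, d (σ j) j (j + 1)
      = ∑ j, (d (σ (j - 1)) 0 j - d (σ j) 0 j) := by
        rw [Finset.sum_sub_distrib, ← hshift, ← Finset.sum_sub_distrib]
        exact Finset.sum_congr rfl fun j _ => hdiff _ _ _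
    _ = ∑ p ∈ wallSet σ, (d (σ (p - 1)) 0 p - d (σ p) 0 p) := by
        refine (Finset.sum_subset (Finset.subset_univ _) fun j _ hj => ?_).symm
        simp only [wallSet, Finset.mem_filter, Finset.mem_univ, true_and, not_not] at hj
        rw [hj, sub_self]
    _ = ∑ p ∈ wallSet σ, d (σ p) p (nextWall (wallSet σ) p) := by
        rw [Finset.sum_sub_distrib, ← hdomain, ← Finset.sum_sub_distrib]
        exact Finset.sum_congr rfl fun p _ => (hdiff _ _ _).symm

/-- For an additive field `d` and `λ ≥ 0`, the Potts energy of
every configuration is bounded below by the domain-wall (Ising) energy of its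
wall set: `H(σ) ≥ E(W(σ))`. -/
theorem potts_energy_ge_ising_energy_of_wallSet (M N : ℕ) [NeZero M] [NeZero N]
    (lam : ℝ) (hlam : 0 ≤ lam)
    (d : Fin N → ZMod M → ZMod M → ℝ)
    (hadd : ∀ (i : Fin N) (j l k : ZMod M), d i j l + d i l k = d i j k) :
    ∀ σ : ZMod M → Fin N, isingEnergy lam d (wallSet σ) ≤ pottsEnergy lam d σ := by
  intro σ
  rw [pottsEnergy, sum_field_eq_sum_domains hadd σ, card_filter_spin_eq, isingEnergy]
  split_ifs with hW
  · gcongr with p hp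
    exact Finset.le_sup' (fun i => d i p (nextWall (wallSet σ) p)) (Finset.mem_univ (σ p))
  · rw [Finset.not_nonempty_iff_eq_empty.mp hW]
    simp
end

section
/- Let M ≥ 1, N ≥ 1, λ ≥ 0, and let d : Fin N → ZMod M → ZMod M → ℝ be additive. Then every domain-wall energy level is realizable or beatable by a spin configuration: for every finset W ⊆ ZMod M there exists a configuration σ : ZMod M → Fin N with Potts energy H(σ) ≤ E(W). -/
/-- The last site of `W` at or before `j` on the cycle (or `j` itself when `W` is empty). -/
noncomputable def prevWall {M : ℕ} (W : Finset (ZMod M)) (j : ZMod M) : ZMod M :=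
  open Classical in
  if h : ∃ k : ℕ, j - (k : ZMod M) ∈ W then j - ((Nat.find h : ℕ) : ZMod M) else j

theorem prevWall_of_mem {M : ℕ} {W : Finset (ZMod M)} {j : ZMod M} (hj : j ∈ W) :
    prevWall W j = j := by
  classical
  have h : ∃ k : ℕ, j - (k : ZMod M) ∈ W := ⟨0, by simpa using hj⟩
  have h0 : Nat.find h = 0 := (Nat.find_eq_zero h).2 (by simpa using hj)
  rw [prevWall, dif_pos h]
  simp [h0]

theorem exists_sub_natCast_mem {M : ℕ} [NeZero M] {W : Finset (ZMod M)} (hW : W.Nonempty)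
    (j : ZMod M) : ∃ k : ℕ, j - (k : ZMod M) ∈ W := by
  obtain ⟨w, hw⟩ := hW
  exact ⟨(j - w).val, by simpa using hw⟩

theorem prevWall_add_one {M : ℕ} [NeZero M] {W : Finset (ZMod M)} (hW : W.Nonempty)
    {j : ZMod M} (hj : j + 1 ∉ W) : prevWall W (j + 1) = prevWall W j := by
  classical
  have h := exists_sub_natCast_mem hW j
  have h' := exists_sub_natCast_mem hW (j + 1)
  have hfind : Nat.find h' = Nat.find h + 1 :=
    Nat.find_comp_succ h' (by simpa using h) (by simpa using hj) |>.trans (by simp)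
  rw [prevWall, prevWall, dif_pos h, dif_pos h', hfind]
  push_cast
  ring

theorem nextWall_mem_and_prevWall {M : ℕ} [NeZero M] {W : Finset (ZMod M)} {p : ZMod M}
    (hp : p ∈ W) : nextWall W p ∈ W ∧ prevWall W (nextWall W p - 1) = p := by
  classical
  have h : ∃ k : ℕ, 0 < k ∧ p + (k : ZMod M) ∈ W :=
    ⟨M, Nat.pos_of_neZero M, by simpa using hp⟩
  have hprev : ∀ k : ℕ, k < Nat.find h → prevWall W (p + (k : ZMod M)) = p := by
    intro k
    induction k with
    | zero => intro _; simpa using prevWall_of_mem hp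
    | succ k ih =>
      intro hk
      have hnot : p + (k : ZMod M) + 1 ∉ W := fun hmem =>
        Nat.find_min h hk ⟨k.succ_pos, by simpa [add_assoc] using hmem⟩
      rw [Nat.cast_succ, ← add_assoc, prevWall_add_one ⟨p, hp⟩ hnot, ih (by omega)]
  have hspec := Nat.find_spec h
  rw [nextWall, dif_pos h]
  refine ⟨hspec.2, ?_⟩
  have hlast := hprev (Nat.find h - 1) (by omega)
  rwa [Nat.cast_sub hspec.1, Nat.cast_one, ← add_sub_assoc] at hlast

theorem sum_comp_nextWall {M : ℕ} [NeZero M] (W : Finset (ZMod M))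
    (g : ZMod M → ZMod M → ℝ) :
    ∑ p ∈ W, g p (nextWall W p) = ∑ q ∈ W, g (prevWall W (q - 1)) q := by
  have hinj : Set.InjOn (nextWall W) W := fun p hp q hq hpq => by
    rw [← (nextWall_mem_and_prevWall hp).2, hpq, (nextWall_mem_and_prevWall hq).2]
  have himage : W.image (nextWall W) = W :=
    Finset.eq_of_subset_of_card_le
      (Finset.image_subset_iff.2 fun p hp => (nextWall_mem_and_prevWall hp).1)
      (Finset.card_image_of_injOn hinj).ge
  conv_rhs => rw [← himage, Finset.sum_image hinj]
  exact Finset.sum_congr rfl fun p hp => by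
    rw [himage, (nextWall_mem_and_prevWall hp).2]

/-- Summation by segments: if the label of each site is that of the last wall before it, the
increments of `f` along the cycle add up to its increments over the segments between walls. -/
theorem sum_increment_prevWall {M : ℕ} [NeZero M] {W : Finset (ZMod M)} (hW : W.Nonempty)
    (f : ZMod M → ZMod M → ℝ) :
    ∑ j, (f (prevWall W j) (j + 1) - f (prevWall W j) j) =
      ∑ p ∈ W, (f p (nextWall W p) - f p p) := by
  have hshift : ∑ j, f (prevWall W (j - 1)) j = ∑ j, f (prevWall W j) (j + 1) :=
    (Equiv.sum_comp (Equiv.addRight (1 : ZMod M)) fun j => f (prevWall W (j - 1)) j).symm.trans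
      (by simp)
  rw [Finset.sum_sub_distrib, ← hshift, ← Finset.sum_sub_distrib,
    Finset.sum_sub_distrib (s := W), sum_comp_nextWall W f, ← Finset.sum_sub_distrib,
    ← Finset.sum_subset (Finset.subset_univ W)]
  · exact Finset.sum_congr rfl fun q hq => by rw [prevWall_of_mem hq]
  · intro q _ hq
    have hprev : prevWall W q = prevWall W (q - 1) := by
      simpa using prevWall_add_one hW (j := q - 1) (by simpa using hq)
    rw [hprev, sub_self]

theorem card_sub_le_card_filter_prevWall {M N : ℕ} [NeZero M] {W : Finset (ZMod M)}
    (hW : W.Nonempty) (s : ZMod M → Fin N) :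
    M - W.card ≤
      (Finset.univ.filter fun j => s (prevWall W j) = s (prevWall W (j + 1))).card := by
  calc M - W.card = (Wᶜ).card := by rw [Finset.card_compl, ZMod.card]
    _ = (Wᶜ.image fun q => q - 1).card :=
      (Finset.card_image_of_injective _ sub_left_injective).symm
    _ ≤ _ := Finset.card_le_card <| Finset.image_subset_iff.2 fun q hq => by
      have hprev := prevWall_add_one hW (j := q - 1) (by simpa using hq)
      simpa using congrArg s hprev.symm

/-- For an additive field `d` and `λ ≥ 0`, every domain-wall
energy level is realizable or beatable by a spin configuration: for every
finset `W ⊆ ZMod M` there is a configuration `σ` with `H(σ) ≤ E(W)`. -/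
theorem exists_config_potts_le_ising (M N : ℕ) [NeZero M] [NeZero N]
    (lam : ℝ) (hlam : 0 ≤ lam)
    (d : Fin N → ZMod M → ZMod M → ℝ)
    (hadd : ∀ (i : Fin N) (j l k : ZMod M), d i j l + d i l k = d i j k) :
    ∀ W : Finset (ZMod M), ∃ σ : ZMod M → Fin N,
      pottsEnergy lam d σ ≤ isingEnergy lam d W := by
  intro W
  have hd : ∀ i j k, d i j k = d i 0 k - d i 0 j := fun i j k => by
    linarith [hadd i 0 j k]
  by_cases hW : W.Nonempty
  · have hmax : ∀ p, ∃ i : Fin N, Finset.univ.sup' Finset.univ_nonempty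
        (fun i : Fin N => d i p (nextWall W p)) = d i p (nextWall W p) := fun p => by
      obtain ⟨i, -, hi⟩ := Finset.exists_mem_eq_sup' Finset.univ_nonempty
        (fun i : Fin N => d i p (nextWall W p))
      exact ⟨i, hi⟩
    choose s hs using hmax
    refine ⟨fun j => s (prevWall W j), ?_⟩
    have hfield : ∑ j, d (s (prevWall W j)) j (j + 1) =
        ∑ p ∈ W, d (s p) p (nextWall W p) := by
      simpa only [← hd] using sum_increment_prevWall hW fun p q => d (s p) 0 q
    have hcard := mul_le_mul_of_nonneg_left
      (Nat.cast_le (α := ℝ).2 (card_sub_le_card_filter_prevWall hW s)) hlam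
    rw [pottsEnergy, isingEnergy, if_pos hW, hfield, Finset.sum_congr rfl fun p _ => hs p]
    linarith
  · refine ⟨fun _ => 0, ?_⟩
    have hzero : ∑ j : ZMod M, d 0 j (j + 1) = 0 := by
      rw [Finset.sum_congr rfl fun j _ => hd 0 j (j + 1), Finset.sum_sub_distrib, sub_eq_zero]
      exact Equiv.sum_comp (Equiv.addRight (1 : ZMod M)) fun j => d 0 0 j
    simp [pottsEnergy, isingEnergy, hW, hzero, ZMod.card]
end
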